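/- Fix real numbers 1 < α < β and let T = (T_1,…,T_5): ℝ^4 → ℝ^5 be as defined. There exists no proper 4-system P on any interval [q₀,∞) such that μ_T(P) = (0, 0, 0, α(1−α)/(2+α+α²), 0). -/

import Mathlib

open Set Filter

noncomputable section

/-- An `n`-system on the interval `I` (conditions (S1)–(S3)). -/
def IsNSystem (n : ℕ) (I : Set ℝ) (P : ℝ → Fin n → ℝ) : Prop :=
  ∀ q ∈ I,
    ((∀ i, 0 ≤ P q i) ∧ Monotone (P q) ∧ (∑ i, P q i) = q) ∧
    ∃ ε > 0, ∃ k ℓ : Fin n,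
      (∀ t ∈ I ∩ Icc (q - ε) q, P t = P q + Pi.single ℓ (t - q)) ∧
      (∀ t ∈ I ∩ Icc q (q + ε), P t = P q + Pi.single k (t - q)) ∧
      (q ∈ interior I → ℓ < k → ∀ i, ℓ ≤ i → i ≤ k → P q i = P q ℓ)

/-- `P` is proper: its first coordinate (equivalently, by (S1)/(G1), each of its
coordinates) tends to infinity with `q`. -/
def IsProper (n : ℕ) (P : ℝ → Fin n → ℝ) : Prop :=
  ∀ i : Fin n, Tendsto (fun q => P q i) atTop atTop

/-- `μ_T(P) = (liminf q⁻¹ T₁(P(q)), …, liminf q⁻¹ Tₘ(P(q)))`. -/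
def muVec {n m : ℕ} (T : (Fin n → ℝ) → Fin m → ℝ) (P : ℝ → Fin n → ℝ) : Fin m → ℝ :=
  fun i => liminf (fun q : ℝ => T (P q) i / q) atTop

/-- The linear map `T = (T₁,…,T₅) : ℝ⁴ → ℝ⁵` of Section 4. -/
def Tfive (α β : ℝ) (x : Fin 4 → ℝ) : Fin 5 → ℝ :=
  ![-((α - 1) * β) * x 0 - (β - α) * x 1 + (β - 1) * x 3,
    (α - 1) * β * x 0 - (α - 1) * β * x 1 + α * (β - 1) * x 2 - (β - 1) * x 3,
    α * β * (α - 1) * x 0 - α * (α - 1) * x 1 + (β - 1) * x 2 - (β - 1) * x 3,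
    x 2 - x 3,
    -x 1 + x 3]

/-- The smallness conditions imposed on the tolerance `η`. -/
structure Params (α β B M η : ℝ) : Prop where
  hα : 1 < α
  hB : α < B
  hβ : B < β
  hM : B * M = α * (α - 1) * (β - B)
  hη : 0 < η
  h1 : η * 2 < β - 1
  h2 : η * (4 * ((β - 1) * B + M)) < ((α - 1) * β - M - (α - 1) * B) * (β - 1)
  h3 : η * 2 < 1
  h4 : η * (2 * B * β) < (α - 1) * (β - B)
  h5 : η * (2 * β * (2 + α + α ^ 2)) < (β - 1) * (α * (α - 1))
  h6 : η * (2 * ((β - 1) * (2 + α + α ^ 2) + 2 * α + 2) * (2 + α + α ^ 2))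
      < α * (α - 1) * (3 * β + 1) * (B - 1)
  h7 : η * ((3 * ((β - 1) * (2 + α + α ^ 2) + 2 * α + 2) + 2) * (2 + α + α ^ 2))
      < α * (α - 1) * (β - 1) - M

lemma exists_params (α β : ℝ) (hα : 1 < α) (hαβ : α < β) : ∃ B M η, Params α β B M η := by
  obtain ⟨B, hB, hβ⟩ := exists_between hαβ
  have hB0 : 0 < B := by linarith
  obtain ⟨M, hMdef⟩ : ∃ M, M = α * (α - 1) * (β - B) / B := ⟨_, rfl⟩
  have hM : B * M = α * (α - 1) * (β - B) := by rw [hMdef]; field_simp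
  have key : ∀ K s : ℝ, 0 < s → ∀ᶠ η in nhdsWithin (0 : ℝ) (Ioi 0), η * K < s := by
    intro K s hs
    have hc : Tendsto (fun η : ℝ => η * K) (nhdsWithin (0 : ℝ) (Ioi 0)) (nhds (0 * K)) :=
      ((continuous_id.mul continuous_const).tendsto 0).mono_left nhdsWithin_le_nhds
    rw [zero_mul] at hc
    exact hc.eventually (gt_mem_nhds hs)
  have hα1 : 0 < α - 1 := by linarith
  have hβ1 : 0 < β - 1 := by linarith
  have hβB : 0 < β - B := by linarith
  have hα0 : 0 < α := by linarith
  have p2 : 0 < (α - 1) * β - M - (α - 1) * B := by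
    have : 0 < B * ((α - 1) * β - M - (α - 1) * B) := by
      have : B * ((α - 1) * β - M - (α - 1) * B) = (α - 1) * (β - B) * (B - α) := by
        linear_combination -hM
      rw [this]
      have : 0 < B - α := by linarith
      positivity
    exact (pos_iff_pos_of_mul_pos this).1 hB0
  have p7 : 0 < α * (α - 1) * (β - 1) - M := by
    have : 0 < B * (α * (α - 1) * (β - 1) - M) := by
      have : B * (α * (α - 1) * (β - 1) - M) = α * (α - 1) * (β * (B - 1)) := by
        linear_combination -hM
      rw [this]
      have : 0 < B - 1 := by linarith
      have : 0 < β := by linarith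
      positivity
    exact (pos_iff_pos_of_mul_pos this).1 hB0
  have hB1 : 0 < B - 1 := by linarith
  have hβ0 : 0 < β := by linarith
  have hall := (key 2 (β - 1) hβ1).and <| (key (4 * ((β - 1) * B + M)) _ (mul_pos p2 hβ1)).and <|
    (key 2 1 one_pos).and <| (key (2 * B * β) _ (mul_pos hα1 hβB)).and <|
    (key (2 * β * (2 + α + α ^ 2)) ((β - 1) * (α * (α - 1))) (by positivity)).and <|
    (key (2 * ((β - 1) * (2 + α + α ^ 2) + 2 * α + 2) * (2 + α + α ^ 2))
      (α * (α - 1) * (3 * β + 1) * (B - 1)) (by positivity)).and <|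
    (key ((3 * ((β - 1) * (2 + α + α ^ 2) + 2 * α + 2) + 2) * (2 + α + α ^ 2)) _ p7).and
      self_mem_nhdsWithin
  obtain ⟨η, g1, g2, g3, g4, g5, g6, g7, g8⟩ := hall.exists
  exact ⟨B, M, η, hα, hB, hβ, hM, g8, g1, g2, g3, g4, g5, g6, g7⟩

lemma Params.M_nonneg {α β B M η : ℝ} (p : Params α β B M η) : 0 ≤ M := by
  obtain ⟨hα, hB, hβ, hM, -⟩ := p
  have hB0 : 0 < B := by linarith
  have : 0 ≤ B * M := by
    rw [hM]
    have : 0 < α - 1 := by linarith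
    have : 0 < β - B := by linarith
    positivity
  exact nonneg_of_mul_nonneg_right this hB0

/-- Leaving the phase where the two lowest components grow. -/
lemma exit_lemma {α β B M η x0 y x3 : ℝ} (p : Params α β B M η) (h3 : 0 < x3)
    (hd : (β - 1) * (x3 - y) ≤ M * x0 + η * x3)
    (hT1 : -(η * x3) ≤ -((α - 1) * β) * x0 - (β - α) * y + (β - 1) * x3) : B * x0 ≤ y := by
  by_contra! hlt
  have hβ1 : 0 < β - 1 := by linarith [p.hα, p.hB, p.hβ]
  have hα1 : 0 < α - 1 := by linarith [p.hα]
  have a1 : ((α - 1) * β - M - (α - 1) * B) * x0 < 2 * (η * x3) := by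
    nlinarith [mul_pos hα1 (sub_pos.2 hlt)]
  have a2 : (β - 1) * x3 ≤ 2 * ((β - 1) * B + M) * x0 := by
    nlinarith [mul_pos hβ1 (sub_pos.2 hlt), mul_pos (sub_pos.2 p.h1) h3]
  have hx0 : 0 < x0 := by
    have hM := p.M_nonneg
    have hB0 : 0 < B := by linarith [p.hα, p.hB]
    have : 0 < 2 * ((β - 1) * B + M) := by positivity
    have h : 0 < 2 * ((β - 1) * B + M) * x0 := lt_of_lt_of_le (by positivity) a2
    exact (pos_iff_pos_of_mul_pos h).1 this
  have b1 := mul_lt_mul_of_pos_left a1 hβ1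
  have b2 := mul_le_mul_of_nonneg_left a2 p.hη.le
  have b3 := mul_lt_mul_of_pos_right p.h2 hx0
  linarith

lemma init_lemma {α β B M η x0 x1 x3 : ℝ} (p : Params α β B M η) (h3 : 0 < x3)
    (hd : x3 - x1 ≤ η * x3)
    (hT1 : -(η * x3) ≤ -((α - 1) * β) * x0 - (β - α) * x1 + (β - 1) * x3) : B * x0 ≤ x1 := by
  by_contra! hlt
  have hβ1 : 0 < β - 1 := by linarith [p.hα, p.hB, p.hβ]
  have hα1 : 0 < α - 1 := by linarith [p.hα]
  have a1 : (α - 1) * (β - B) * x0 < β * (η * x3) := by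
    nlinarith [mul_pos hα1 (sub_pos.2 hlt), mul_le_mul_of_nonneg_left hd hβ1.le]
  have a2 : x3 ≤ 2 * B * x0 := by
    nlinarith [mul_pos (sub_pos.2 p.h3) h3]
  have hB0 : 0 < B := by linarith [p.hα, p.hB]
  have hβ0 : 0 < β := by linarith
  have hx0 : 0 < x0 := by
    have h : 0 < 2 * B * x0 := lt_of_lt_of_le h3 a2
    exact (pos_iff_pos_of_mul_pos h).1 (by positivity)
  have b2 := mul_le_mul_of_nonneg_left a2 (mul_pos hβ0 p.hη).le
  have b3 := mul_lt_mul_of_pos_right p.h4 hx0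
  linarith

/-- The invariant, for a point `x` at which component `k` is about to grow. -/
def Cond (β B M η : ℝ) (k : Fin 4) (x : Fin 4 → ℝ) : Prop :=
  (k ≠ 0 ∧ B * x 0 ≤ x 1) ∨
  (k = 0 ∧ (β - 1) * (x 3 - x 2) ≤ M * x 1 + η * x 3) ∨
  (k ≤ 1 ∧ (β - 1) * (x 3 - x 2) ≤ M * x 0 + η * x 3)

lemma start_cond {α β B M η : ℝ} (p : Params α β B M η) (k : Fin 4) (x : Fin 4 → ℝ)
    (hI : B * x 0 ≤ x 1) (hT3 : -(η * x 3) ≤ Tfive α β x 2) : Cond β B M η k x := by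
  by_cases hk : k = 0
  · right; left
    refine ⟨hk, ?_⟩
    simp [Tfive] at hT3
    have hB0 : 0 < B := by linarith [p.hα, p.hB]
    have hα1 : 0 < α - 1 := by linarith [p.hα]
    have hα0 : 0 < α := by linarith [p.hα]
    have hβ0 : 0 < β := by linarith [p.hB, p.hβ]
    have key : α * (α - 1) * (β * x 0 - x 1) ≤ M * x 1 := by
      have h : B * (α * (α - 1) * (β * x 0 - x 1)) ≤ B * (M * x 1) := by
        have e : B * (M * x 1) = α * (α - 1) * (β - B) * x 1 := by rw [← mul_assoc, p.hM]
        rw [e]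
        have := mul_le_mul_of_nonneg_left hI (show 0 ≤ α * (α - 1) * β by positivity)
        linarith
      exact le_of_mul_le_mul_left h hB0
    linarith
  · exact Or.inl ⟨hk, hI⟩

lemma switch {α β B M η : ℝ} (p : Params α β B M η) (k l : Fin 4) (x : Fin 4 → ℝ)
    (hmono : Monotone x) (h3 : 0 < x 3)
    (hc : Cond β B M η l x) (hs : l < k → ∀ i, l ≤ i → i ≤ k → x i = x l)
    (hT1 : -(η * x 3) ≤ Tfive α β x 0) (hT3 : -(η * x 3) ≤ Tfive α β x 2) :
    Cond β B M η k x := by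
  have hM := p.M_nonneg
  have h01 : x 0 ≤ x 1 := hmono (by decide)
  have hexit : x 1 = x 2 → (β - 1) * (x 3 - x 2) ≤ M * x 0 + η * x 3 → Cond β B M η k x := by
    intro h12 hd
    refine start_cond p k x ?_ hT3
    refine exit_lemma p h3 (h12 ▸ hd) ?_
    simpa [Tfive] using hT1
  rcases hc with ⟨_, h⟩ | ⟨hl, h⟩ | ⟨hl, h⟩
  · exact start_cond p k x h hT3
  · subst hl
    by_cases hk : k = 0
    · exact Or.inr (Or.inl ⟨hk, h⟩)
    have hk0 : 0 < k := Fin.pos_iff_ne_zero.2 hk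
    have e1 : x 1 = x 0 := hs hk0 1 (by decide) (by omega)
    rw [e1] at h
    by_cases hk1 : k ≤ 1
    · exact Or.inr (Or.inr ⟨hk1, h⟩)
    · exact hexit (by rw [e1, hs hk0 2 (by decide) (by omega)]) h
  · by_cases hk1 : k ≤ 1
    · exact Or.inr (Or.inr ⟨hk1, h⟩)
    · have hlk : l < k := by omega
      exact hexit (by rw [hs hlk 1 (by omega) (by omega), hs hlk 2 (by omega) (by omega)]) h

lemma cond_grow {α β B M η : ℝ} (p : Params α β B M η) (k : Fin 4) (x y : Fin 4 → ℝ) (h : ℝ)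
    (hh : 0 ≤ h) (hy : y = x + Pi.single k h) (hc : Cond β B M η k x) : Cond β B M η k y := by
  have hM := p.M_nonneg
  have := mul_nonneg hM hh
  subst hy
  unfold Cond at *
  fin_cases k <;> simp at hc ⊢ <;> first | linarith | skip
  all_goals
    rcases hc with hc | hc
    · left; linarith
    · right; linarith

lemma final_lemma {α β B M η : ℝ} (p : Params α β B M η) (k : Fin 4) (x : Fin 4 → ℝ) (q : ℝ)
    (hmono : Monotone x) (h0 : 0 ≤ x 0) (h3 : 0 < x 3) (hq : x 0 + x 1 + x 2 + x 3 = q)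
    (hT2 : -(η * x 3) ≤ Tfive α β x 1) (hT3 : -(η * x 3) ≤ Tfive α β x 2)
    (hT4 : α * (α - 1) / (2 + α + α ^ 2) * q - η * x 3 ≤ x 3 - x 2)
    (hc : Cond β B M η k x) : False := by
  have hM := p.M_nonneg
  have h01 : x 0 ≤ x 1 := hmono (by decide)
  have h12 : x 1 ≤ x 2 := hmono (by decide)
  have hα1 : 0 < α - 1 := by linarith [p.hα]
  have hα0 : 0 < α := by linarith
  have hB1 : 0 < B - 1 := by linarith [p.hα, p.hB]
  have hβ1 : 0 < β - 1 := by linarith [p.hβ]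
  have hβ0 : 0 < β := by linarith
  have hη := p.hη
  simp [Tfive] at hT2 hT3
  obtain ⟨N, hN⟩ : ∃ N, N = 2 + α + α ^ 2 := ⟨_, rfl⟩
  obtain ⟨g, hg⟩ : ∃ g, g = α * (α - 1) := ⟨_, rfl⟩
  have hN0 : 0 < N := by rw [hN]; positivity
  have hg0 : 0 < g := by rw [hg]; positivity
  obtain ⟨E, hE⟩ : ∃ E, E = (β - 1) * N + 2 * α + 2 := ⟨_, rfl⟩
  have hE0 : 0 < E := by rw [hE]; positivity
  have h5 := p.h5
  have h6 := p.h6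
  have h7 := p.h7
  rw [← hN, ← hg] at h5 h6 h7 hT4
  rw [← hE] at h6 h7
  have hT4' : g * q - N * (η * x 3) ≤ N * (x 3 - x 2) := by
    have := mul_le_mul_of_nonneg_left hT4 hN0.le
    have e : N * (g / N * q - η * x 3) = g * q - N * (η * x 3) := by field_simp
    linarith
  have hT3' : (β - 1) * (x 3 - x 2) ≤ g * (β * x 0 - x 1) + η * x 3 := by
    rw [hg]; linarith
  have hT2' : 2 * g * (β - 1) * x 2 ≥ 2 * α * (β - 1) * (x 3 - x 2) + 2 * g * β * (x 1 - x 0)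
      - 2 * α * (η * x 3) := by
    rw [hg]
    have := mul_le_mul_of_nonneg_left hT2 (show 0 ≤ 2 * α by positivity)
    linarith
  have hb : 2 * g * (β - 1) * x 0 + g * (β - 1) * (x 1 - x 0) + 2 * g * β * (x 1 - x 0) ≤
      2 * (β - 1) * (x 3 - x 2) + (E - 2) * (η * x 3) := by
    have h := mul_le_mul_of_nonneg_left hT4' hβ1.le
    have hNe : N = 2 + g + 2 * α := by rw [hN, hg]; ring
    rw [hE]
    rw [← hq] at h
    have e : (β - 1) * (N * (x 3 - x 2)) = (β - 1) * (2 + g + 2 * α) * (x 3 - x 2) := by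
      rw [hNe]; ring
    rw [e] at h
    linarith
  have hηx : 0 < η * x 3 := mul_pos hη h3
  have ha : g * (3 * β + 1) * (x 1 - x 0) ≤ E * (η * x 3) := by
    linarith
  have hx3 : x 3 ≤ 2 * N * x 0 := by
    have i1 : g * x 3 ≤ N * (x 3 - x 2) + N * (η * x 3) := by
      have : g * x 3 ≤ g * q := by
        apply mul_le_mul_of_nonneg_left _ hg0.le
        linarith
      linarith
    have i2 : (β - 1) * (x 3 - x 2) ≤ g * (β - 1) * x 0 + η * x 3 := by
      have := mul_le_mul_of_nonneg_left h01 hg0.le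
      linarith
    have j1 := mul_le_mul_of_nonneg_left i1 hβ1.le
    have j2 := mul_le_mul_of_nonneg_left i2 hN0.le
    have j3 := mul_lt_mul_of_pos_right h5 h3
    have : g * (β - 1) * x 3 ≤ g * (β - 1) * (2 * N * x 0) := by linarith
    exact le_of_mul_le_mul_left this (by positivity)
  have hx0 : 0 < x 0 := by
    have h : 0 < 2 * N * x 0 := lt_of_lt_of_le h3 hx3
    exact (pos_iff_pos_of_mul_pos h).1 (by positivity)
  have hII : (β - 1) * (x 3 - x 2) ≤ M * x 1 + η * x 3 → False := by
    intro h
    have hM7 : M ≤ g * (3 * β + 1) := by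
      have : 0 < η * ((3 * E + 2) * N) := by positivity
      have : g * (β - 1) ≤ g * (3 * β + 1) := mul_le_mul_of_nonneg_left (by linarith) hg0.le
      linarith
    have i1 := mul_le_mul_of_nonneg_right hM7 (sub_nonneg.2 h01)
    have n1 : 0 ≤ g * (β - 1) * (x 1 - x 0) := mul_nonneg (by positivity) (sub_nonneg.2 h01)
    have n2 : 0 ≤ 2 * g * β * (x 1 - x 0) := mul_nonneg (by positivity) (sub_nonneg.2 h01)
    have i2 : 2 * (g * (β - 1) - M) * x 0 ≤ (3 * E + 2) * (η * x 3) := by linarith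
    have i3 := mul_le_mul_of_nonneg_left hx3 (show 0 ≤ (3 * E + 2) * η by positivity)
    have i4 := mul_lt_mul_of_pos_right h7 hx0
    linarith
  rcases hc with ⟨_, h⟩ | ⟨_, h⟩ | ⟨_, h⟩
  · have i1 : g * (3 * β + 1) * ((B - 1) * x 0) ≤ g * (3 * β + 1) * (x 1 - x 0) :=
      mul_le_mul_of_nonneg_left (by linarith) (by positivity)
    have i3 := mul_le_mul_of_nonneg_left hx3 (show 0 ≤ E * η by positivity)
    have i4 := mul_lt_mul_of_pos_right h6 hx0
    linarith
  · exact hII h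
  · exact hII (by have := mul_le_mul_of_nonneg_left h01 hM; linarith)

/-- The invariant as a statement on the right germ of `P` at `q`. -/
def Germ (β B M η : ℝ) (P : ℝ → Fin 4 → ℝ) (q : ℝ) : Prop :=
  ∃ k : Fin 4, ∃ ε > 0, (∀ t ∈ Icc q (q + ε), P t = P q + Pi.single k (t - q)) ∧
    Cond β B M η k (P q)

lemma propagate {α β B M η q₀ q₁ : ℝ} (p : Params α β B M η) {P : ℝ → Fin 4 → ℝ}
    (hP : IsNSystem 4 (Ici q₀) P) (h01 : q₀ ≤ q₁)
    (h3 : ∀ q ≥ q₁, 0 < P q 3)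
    (hT1 : ∀ q ≥ q₁, -(η * P q 3) ≤ Tfive α β (P q) 0)
    (hT3 : ∀ q ≥ q₁, -(η * P q 3) ≤ Tfive α β (P q) 2)
    (hstart : Germ β B M η P q₁) : ∀ q ≥ q₁, Germ β B M η P q := by
  by_contra! hbad
  obtain ⟨b, hb1, hb⟩ := hbad
  let S : Set ℝ := {q | q₁ ≤ q ∧ ¬ Germ β B M η P q}
  have hSne : S.Nonempty := ⟨b, hb1, hb⟩
  have hSb : BddBelow S := ⟨q₁, fun q hq => hq.1⟩
  obtain ⟨c, hcdef⟩ : ∃ c, c = sInf S := ⟨_, rfl⟩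
  have hc1 : q₁ ≤ c := hcdef ▸ le_csInf hSne fun q hq => hq.1
  have hgood : ∀ q, q₁ ≤ q → q < c → Germ β B M η P q := by
    intro q hq hqc
    by_contra hn
    exact absurd (csInf_le hSb (show q ∈ S from ⟨hq, hn⟩)) (by rw [← hcdef]; exact not_le.2 hqc)
  have hc : Germ β B M η P c := by
    rcases hc1.eq_or_lt with h | hlt
    · rwa [← h]
    obtain ⟨⟨-, hmono, -⟩, ε, hε, k, l, hl, hr, hs⟩ := hP c (h01.trans hc1)
    obtain ⟨t, ht1, htc⟩ : ∃ t, max q₁ (c - ε) < t ∧ t < c :=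
      exists_between (max_lt hlt (by linarith))
    have htq : q₁ < t := lt_of_le_of_lt (le_max_left _ _) ht1
    have hte : c - ε < t := lt_of_le_of_lt (le_max_right _ _) ht1
    obtain ⟨k', ε', hε', hr', hcond⟩ := hgood t htq.le htc
    have hPt : P t = P c + Pi.single l (t - c) := hl t ⟨h01.trans htq.le, hte.le, htc.le⟩
    have hkl : k' = l := by
      by_contra hne
      obtain ⟨s, hs1, hs2⟩ : ∃ s, t < s ∧ s < min c (t + ε') :=
        exists_between (lt_min htc (by linarith))
      have hsc : s < c := lt_of_lt_of_le hs2 (min_le_left _ _)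
      have hse : s < t + ε' := lt_of_lt_of_le hs2 (min_le_right _ _)
      have e1 := congrFun (hr' s ⟨hs1.le, hse.le⟩) k'
      have e2 := congrFun (hl s ⟨h01.trans (htq.trans hs1).le, (hte.trans hs1).le, hsc.le⟩) k'
      have e3 := congrFun hPt k'
      simp [hne] at e1 e2 e3
      linarith
    subst hkl
    have hcc : Cond β B M η k' (P c) := by
      refine cond_grow p k' (P t) (P c) (c - t) (by linarith) ?_ hcond
      rw [hPt, add_assoc, ← Pi.single_add]
      simp
    refine ⟨k, ε, hε, fun t ht => hr t ⟨(h01.trans hc1).trans ht.1, ht⟩, ?_⟩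
    refine switch p k k' (P c) hmono (h3 c hc1) hcc (hs ?_) (hT1 c hc1) (hT3 c hc1)
    rw [interior_Ici]
    exact lt_of_le_of_lt h01 hlt
  obtain ⟨k, ε, hε, hr, hcond⟩ := hc
  have : c + ε ≤ sInf S := by
    refine le_csInf hSne fun q hq => ?_
    by_contra! hlt
    have hcq : c ≤ q := hcdef ▸ csInf_le hSb hq
    apply hq.2
    have hPq := hr q ⟨hcq, hlt.le⟩
    refine ⟨k, c + ε - q, by linarith, ?_, cond_grow p k _ _ (q - c) (by linarith) hPq hcond⟩
    intro t ht
    rw [hPq, hr t ⟨hcq.trans ht.1, by linarith [ht.2]⟩, add_assoc, ← Pi.single_add]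
    simp
  linarith

lemma bdd_aux {q₀ : ℝ} {P : ℝ → Fin 4 → ℝ} (hP : IsNSystem 4 (Ici q₀) P)
    (c : Fin 4 → ℝ) : ∃ K, ∀ᶠ q in atTop, |(∑ i, c i * P q i) / q| ≤ K := by
  refine ⟨∑ i, |c i|, ?_⟩
  filter_upwards [eventually_ge_atTop q₀, eventually_gt_atTop 0] with q hq hq0
  obtain ⟨⟨hnn, -, hsum⟩, -⟩ := hP q hq
  rw [abs_div, abs_of_pos hq0, div_le_iff₀ hq0, Finset.sum_mul]
  refine (Finset.abs_sum_le_sum_abs _ _).trans (Finset.sum_le_sum fun i _ => ?_)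
  rw [abs_mul, abs_of_nonneg (hnn i)]
  refine mul_le_mul_of_nonneg_left ?_ (abs_nonneg _)
  exact (Finset.single_le_sum (fun j _ => hnn j) (Finset.mem_univ i)).trans hsum.le

lemma liminf_aux {f : ℝ → ℝ} {K L δ : ℝ} (hK : ∀ᶠ q in atTop, |f q| ≤ K)
    (hL : liminf f atTop = L) (hδ : 0 < δ) :
    (∀ᶠ q in atTop, L - δ < f q) ∧ ∃ᶠ q in atTop, f q < L + δ := by
  have hb : IsBoundedUnder (· ≥ ·) atTop f :=
    isBoundedUnder_of_eventually_ge (a := -K) (hK.mono fun q h => (abs_le.1 h).1)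
  have ha : IsBoundedUnder (· ≤ ·) atTop f :=
    isBoundedUnder_of_eventually_le (a := K) (hK.mono fun q h => (abs_le.1 h).2)
  exact ⟨eventually_lt_of_lt_liminf (by linarith) hb,
    frequently_lt_of_liminf_lt ha.isCoboundedUnder_ge (by linarith)⟩

lemma tfive_bdd {q₀ α β : ℝ} {P : ℝ → Fin 4 → ℝ} (hP : IsNSystem 4 (Ici q₀) P)
    (j : Fin 5) : ∃ K, ∀ᶠ q in atTop, |Tfive α β (P q) j / q| ≤ K := by
  obtain ⟨c, hc⟩ : ∃ c : Fin 4 → ℝ, ∀ x, Tfive α β x j = ∑ i, c i * x i := by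
    refine ⟨fun i => Tfive α β (Pi.single i 1) j, fun x => ?_⟩
    fin_cases j <;> simp [Tfive, Fin.sum_univ_four] <;> ring
  obtain ⟨K, hK⟩ := bdd_aux hP c
  exact ⟨K, by simpa only [hc] using hK⟩

theorem stmt_10 (α β : ℝ) (hα : 1 < α) (hαβ : α < β) :
    ¬∃ q₀ : ℝ, 0 ≤ q₀ ∧ ∃ P : ℝ → Fin 4 → ℝ, IsNSystem 4 (Ici q₀) P ∧
      IsProper 4 P ∧
      muVec (Tfive α β) P = ![0, 0, 0, α * (1 - α) / (2 + α + α ^ 2), 0] := by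
  rintro ⟨q₀, hq₀, P, hP, -, hmu⟩
  obtain ⟨B, M, η, p⟩ := exists_params α β hα hαβ
  have hη4 : 0 < η / 4 := by linarith [p.hη]
  have hlim : ∀ (j : Fin 5) (L : ℝ),
      (![0, 0, 0, α * (1 - α) / (2 + α + α ^ 2), 0] : Fin 5 → ℝ) j = L →
      (∀ᶠ q in atTop, L - η / 4 < Tfive α β (P q) j / q) ∧
        ∃ᶠ q in atTop, Tfive α β (P q) j / q < L + η / 4 := by
    intro j L hL
    obtain ⟨K, hK⟩ := tfive_bdd (α := α) (β := β) hP j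
    exact liminf_aux hK ((congrFun hmu j).trans hL) hη4
  have hbasic : ∀ q, q₀ ≤ q → 0 < q → q ≤ 4 * P q 3 ∧ 0 < P q 3 := by
    intro q hq hq0
    obtain ⟨⟨hnn, hmono, hsum⟩, -⟩ := hP q hq
    rw [Fin.sum_univ_four] at hsum
    have a0 : P q 0 ≤ P q 3 := hmono (by decide)
    have a1 : P q 1 ≤ P q 3 := hmono (by decide)
    have a2 : P q 2 ≤ P q 3 := hmono (by decide)
    constructor <;> linarith
  have hlow : ∀ j : Fin 5, (![0, 0, 0, α * (1 - α) / (2 + α + α ^ 2), 0] : Fin 5 → ℝ) j = 0 →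
      ∀ᶠ q in atTop, -(η * P q 3) ≤ Tfive α β (P q) j := by
    intro j hj
    filter_upwards [(hlim j 0 hj).1, eventually_ge_atTop q₀, eventually_gt_atTop 0] with q h hq hq0
    rw [lt_div_iff₀ hq0] at h
    have := mul_le_mul_of_nonneg_left (hbasic q hq hq0).1 hη4.le
    linarith
  obtain ⟨Q, hQ⟩ := eventually_atTop.1 ((hlow 0 rfl).and <| (hlow 1 rfl).and <| (hlow 2 rfl).and <|
    (eventually_ge_atTop q₀).and (eventually_gt_atTop 0))
  obtain ⟨q₁, hq₁, h5⟩ := frequently_atTop.1 (hlim 4 0 rfl).2 Q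
  have hQ1 : ∀ q ≥ q₁, _ := fun q hq => hQ q (hq₁.trans hq)
  obtain ⟨t1, t2, t3, hq01, hq10⟩ := hQ q₁ hq₁
  have hgerm : Germ β B M η P q₁ := by
    obtain ⟨-, ε, hε, k, l, -, hr, -⟩ := hP q₁ hq01
    refine ⟨k, ε, hε, fun t ht => hr t ⟨hq01.trans ht.1, ht⟩, start_cond p k _ ?_ t3⟩
    refine init_lemma p (hbasic q₁ hq01 hq10).2 ?_ (by simpa [Tfive] using t1)
    rw [div_lt_iff₀ hq10] at h5
    have := mul_le_mul_of_nonneg_left (hbasic q₁ hq01 hq10).1 hη4.le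
    simp [Tfive] at h5
    linarith
  have hall := propagate p hP hq01
    (fun q hq => (hbasic q (hQ1 q hq).2.2.2.1 (hQ1 q hq).2.2.2.2).2)
    (fun q hq => (hQ1 q hq).1) (fun q hq => (hQ1 q hq).2.2.1) hgerm
  obtain ⟨q, hq, h4⟩ := frequently_atTop.1 (hlim 3 _ rfl).2 q₁
  obtain ⟨-, s2, s3, hq0, hqpos⟩ := hQ1 q hq
  obtain ⟨k, -, -, -, hcond⟩ := hall q hq
  obtain ⟨⟨hnn, hmono, hsum⟩, -⟩ := hP q hq0
  rw [Fin.sum_univ_four] at hsum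
  refine final_lemma p k (P q) q hmono (hnn 0) (hbasic q hq0 hqpos).2 hsum s2 s3 ?_ hcond
  rw [div_lt_iff₀ hqpos] at h4
  have := mul_le_mul_of_nonneg_left (hbasic q hq0 hqpos).1 hη4.le
  simp [Tfive] at h4
  have e : α * (1 - α) / (2 + α + α ^ 2) = -(α * (α - 1) / (2 + α + α ^ 2)) := by ring
  rw [e] at h4
  linarith
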